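/- arXiv:1909.07467 — 5 statements merged into one kernel-verified Lean document; each statement's English description precedes it below -/
import Mathlib

section
/- Let K > 0 and t₀ < T (with T possibly +∞). If s : [t₀, T) → ℝ is differentiable with s(t) > 0 and s'(t) ≤ -K √(s(t)) for all t ∈ [t₀, T), then T ≤ t₀ + 2√(s(t₀)) / K; in particular, no such positive solution can exist on all of [t₀, ∞). -/
/-- let `K > 0` and `t₀ < T` (with `T` possibly `+∞`). If `s : [t₀, T) → ℝ`
is differentiable with `s(t) > 0` and `s'(t) ≤ -K √(s t)` on `[t₀, T)`, then
`T ≤ t₀ + 2 √(s t₀) / K`; in particular, no such positive solution can exist on all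
of `[t₀, ∞)`. -/
theorem finite_time_of_sqrt_decay (K t₀ : ℝ) (hK : 0 < K) :
    (∀ T : ℝ, t₀ < T → ∀ s : ℝ → ℝ,
      (∀ t ∈ Set.Ico t₀ T, DifferentiableAt ℝ s t ∧ 0 < s t ∧
        deriv s t ≤ -K * Real.sqrt (s t)) →
      T ≤ t₀ + 2 * Real.sqrt (s t₀) / K) ∧
    (∀ s : ℝ → ℝ, ¬ (∀ t ∈ Set.Ici t₀, DifferentiableAt ℝ s t ∧ 0 < s t ∧
        deriv s t ≤ -K * Real.sqrt (s t))) := by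
  have key : ∀ T : ℝ, t₀ < T → ∀ s : ℝ → ℝ,
      (∀ t ∈ Set.Ico t₀ T, DifferentiableAt ℝ s t ∧ 0 < s t ∧
        deriv s t ≤ -K * Real.sqrt (s t)) →
      T ≤ t₀ + 2 * Real.sqrt (s t₀) / K := by
    intro T hT s h
    by_contra! hlt
    set u := t₀ + 2 * Real.sqrt (s t₀) / K with hu
    have hu0 : t₀ ≤ u := by
      have : 0 ≤ 2 * Real.sqrt (s t₀) / K := by positivity
      linarith
    have hd : ∀ t ∈ Set.Icc t₀ u, HasDerivAt (fun t => Real.sqrt (s t) + K / 2 * t)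
        (deriv s t / (2 * Real.sqrt (s t)) + K / 2 * 1) t := by
      intro t ht
      obtain ⟨h1, h2, _⟩ := h t ⟨ht.1, ht.2.trans_lt hlt⟩
      exact (h1.hasDerivAt.sqrt h2.ne').add ((hasDerivAt_id t).const_mul (K / 2))
    have hanti : AntitoneOn (fun t => Real.sqrt (s t) + K / 2 * t) (Set.Icc t₀ u) := by
      apply antitoneOn_of_deriv_nonpos (convex_Icc t₀ u)
      · exact fun t ht => (hd t ht).continuousAt.continuousWithinAt
      · exact fun t ht => (hd t (interior_subset ht)).differentiableAt.differentiableWithinAt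
      · intro t ht
        have ht' := interior_subset ht
        rw [(hd t ht').deriv]
        obtain ⟨_, h2, h3⟩ := h t ⟨ht'.1, ht'.2.trans_lt hlt⟩
        have hp := Real.sqrt_pos.2 h2
        have : deriv s t / (2 * Real.sqrt (s t)) ≤ -(K / 2) := by
          rw [div_le_iff₀ (by positivity)]
          linarith
        linarith
    have h4 := hanti (Set.left_mem_Icc.2 hu0) (Set.right_mem_Icc.2 hu0) hu0
    have h5 := Real.sqrt_pos.2 (h u ⟨hu0, hlt⟩).2.1
    have h6 : K / 2 * u = K / 2 * t₀ + Real.sqrt (s t₀) := by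
      rw [hu]; field_simp
    simp only at h4
    linarith
  refine ⟨key, fun s h => ?_⟩
  have h0 : 0 ≤ 2 * Real.sqrt (s t₀) / K := by positivity
  have := key (t₀ + 2 * Real.sqrt (s t₀) / K + 1) (by linarith) s (fun t ht => h t ht.1)
  linarith
end

section
/- Let c > 0 and t₀ ∈ ℝ. If V : [t₀, ∞) → ℝ is differentiable, V(t) ≥ 0 for all t ≥ t₀, and V'(t) ≤ -c √(V(t)) at every t with V(t) > 0, then V(t) = 0 for all t ≥ t₀ + 2√(V(t₀)) / c. -/
/-- let `c > 0` and `t₀ ∈ ℝ`. If `V : [t₀, ∞) → ℝ` is differentiable,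
`V(t) ≥ 0` for every `t ≥ t₀`, and `V'(t) ≤ -c √(V t)` at every `t ≥ t₀` with `V(t) > 0`,
then `V(t) = 0` for all `t ≥ t₀ + 2 √(V t₀) / c`. -/
theorem finite_time_extinction (c t₀ : ℝ) (hc : 0 < c) (V : ℝ → ℝ)
    (hdiff : ∀ t : ℝ, t₀ ≤ t → DifferentiableAt ℝ V t)
    (hnonneg : ∀ t : ℝ, t₀ ≤ t → 0 ≤ V t)
    (hder : ∀ t : ℝ, t₀ ≤ t → 0 < V t → deriv V t ≤ -c * Real.sqrt (V t)) :
    ∀ t : ℝ, t₀ + 2 * Real.sqrt (V t₀) / c ≤ t → V t = 0 := by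
  intro t ht
  have hs0 : 0 ≤ 2 * Real.sqrt (V t₀) / c := by positivity
  have ht0 : t₀ ≤ t := by linarith
  have hanti : AntitoneOn V (Set.Ici t₀) := by
    apply antitoneOn_of_deriv_nonpos (convex_Ici t₀)
    · intro x hx
      exact (hdiff x hx).continuousAt.continuousWithinAt
    · intro x hx
      exact (hdiff x (interior_subset hx)).differentiableWithinAt
    · intro x hx
      rw [interior_Ici] at hx
      have hx' : t₀ < x := hx
      rcases (hnonneg x hx'.le).eq_or_lt with h | h
      · have hmin : IsLocalMin V x := by
          filter_upwards [Ioi_mem_nhds hx'] with y hy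
          rw [← h]
          exact hnonneg y (le_of_lt hy)
        exact hmin.deriv_eq_zero.le
      · have h1 := hder x hx'.le h
        have h2 := mul_nonneg hc.le (Real.sqrt_nonneg (V x))
        linarith
  by_contra hne
  have hpos : 0 < V t := lt_of_le_of_ne (hnonneg t ht0) (Ne.symm hne)
  have hVpos : ∀ x ∈ Set.Icc t₀ t, 0 < V x := fun x hx =>
    lt_of_lt_of_le hpos (hanti hx.1 ht0 hx.2)
  have hd : ∀ x ∈ Set.Icc t₀ t, HasDerivAt (fun s => Real.sqrt (V s))
      (deriv V x / (2 * Real.sqrt (V x))) x := fun x hx =>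
    (hdiff x hx.1).hasDerivAt.sqrt (hVpos x hx).ne'
  have key := (convex_Icc t₀ t).image_sub_le_mul_sub_of_deriv_le
    (f := fun s => Real.sqrt (V s)) (C := -c / 2)
    (fun x hx => (hd x hx).continuousAt.continuousWithinAt)
    (fun x hx => (hd x (interior_subset hx)).differentiableAt.differentiableWithinAt)
    (fun x hx => by
      have hx' := interior_subset hx
      rw [(hd x hx').deriv]
      have h1 := hder x hx'.1 (hVpos x hx')
      have h2 := Real.sqrt_pos.2 (hVpos x hx')
      rw [div_le_iff₀ (by positivity)]
      linarith)
    t₀ (Set.left_mem_Icc.2 ht0) t (Set.right_mem_Icc.2 ht0) ht0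
  have h3 : 2 * Real.sqrt (V t₀) ≤ (t - t₀) * c := by
    rw [← div_le_iff₀ hc]
    linarith
  have h4 := Real.sqrt_pos.2 hpos
  nlinarith
end

section
/- Reaching phase of Theorem 1: let ε, L₀, L₁, g, G, M > 0 with g ≤ G. Suppose s, φ, δ : [0, ∞) → ℝ are differentiable, γ : [0, ∞) → ℝ satisfies g ≤ γ(t) ≤ G and |δ'(t)| ≤ M for all t, and at every t ≥ 0 with s(t) > ε/2 the equations s'(t) = γ(t)(-(L₁ t + L₀) √(s(t)) + φ(t)) and φ'(t) = -(L₁ t + L₀)² + δ'(t) hold. Then there exists t̄ ≥ 0 such that s(t̄) ≤ ε/2. -/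
theorem aux_decay (f : ℝ → ℝ) (T c : ℝ) (hf : ∀ t, T ≤ t → DifferentiableAt ℝ f t)
    (hd : ∀ t, T ≤ t → deriv f t ≤ -c) (t : ℝ) (ht : T ≤ t) : f t ≤ f T - c * (t - T) := by
  have h := Convex.image_sub_le_mul_sub_of_deriv_le (convex_Ici T) (f := f) (C := -c)
    (fun x hx => (hf x hx).continuousAt.continuousWithinAt)
    (fun x hx => (hf x (interior_subset hx)).differentiableWithinAt)
    (fun x hx => hd x (interior_subset hx)) T Set.self_mem_Ici t ht ht
  linarith

/-- reaching phase of Theorem 1: let `ε, L₀, L₁, g, G, M > 0` with `g ≤ G`.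
Suppose `s, φ, δ : [0, ∞) → ℝ` are differentiable, `γ` satisfies `g ≤ γ(t) ≤ G` and
`|δ'(t)| ≤ M` for all `t ≥ 0`, and at every `t ≥ 0` with `s(t) > ε/2` the super-twisting
equations `s' = γ (-(L₁ t + L₀) √s + φ)` and `φ' = -(L₁ t + L₀)² + δ'` hold.
Then there exists `t̄ ≥ 0` with `s(t̄) ≤ ε/2`. -/
theorem reaching_phase (ε L₀ L₁ g G M : ℝ)
    (hε : 0 < ε) (hL₀ : 0 < L₀) (hL₁ : 0 < L₁)
    (hg : 0 < g) (hgG : g ≤ G) (hM : 0 < M)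
    (s φ δ γ : ℝ → ℝ)
    (hs : ∀ t : ℝ, 0 ≤ t → DifferentiableAt ℝ s t)
    (hφ : ∀ t : ℝ, 0 ≤ t → DifferentiableAt ℝ φ t)
    (hδ : ∀ t : ℝ, 0 ≤ t → DifferentiableAt ℝ δ t)
    (hγ : ∀ t : ℝ, 0 ≤ t → g ≤ γ t ∧ γ t ≤ G)
    (hδ' : ∀ t : ℝ, 0 ≤ t → |deriv δ t| ≤ M)
    (heq : ∀ t : ℝ, 0 ≤ t → ε / 2 < s t →
      deriv s t = γ t * (-(L₁ * t + L₀) * Real.sqrt (s t) + φ t) ∧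
      deriv φ t = -(L₁ * t + L₀) ^ 2 + deriv δ t) :
    ∃ tbar : ℝ, 0 ≤ tbar ∧ s tbar ≤ ε / 2 := by
  by_contra hcon
  push Not at hcon
  have hT1 : 0 ≤ (M + 1) / L₁ := by positivity
  obtain ⟨T1, hT1d⟩ : ∃ T, T = (M + 1) / L₁ := ⟨_, rfl⟩
  rw [← hT1d] at hT1
  have hLT : L₁ * T1 = M + 1 := by rw [hT1d]; field_simp
  have h1 := aux_decay φ T1 1 (fun t ht => hφ t (by linarith)) (by
    intro t ht
    have h0 : 0 ≤ t := by linarith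
    rw [(heq t h0 (hcon t h0)).2]
    have h2 := (abs_le.1 (hδ' t h0)).2
    have h3 : L₁ * T1 ≤ L₁ * t := by gcongr
    nlinarith)
  have ha := le_abs_self (φ T1)
  have hb := abs_nonneg (φ T1)
  obtain ⟨T2, hT2⟩ : ∃ T, T = T1 + |φ T1| + 1 := ⟨_, rfl⟩
  have hT20 : 0 ≤ T2 := by linarith
  have h2 := aux_decay s T2 g (fun t ht => hs t (by linarith)) (by
    intro t ht
    have h0 : 0 ≤ t := by linarith
    rw [(heq t h0 (hcon t h0)).1]
    have hp : φ t ≤ -1 := by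
      have := h1 t (by linarith)
      linarith
    have hq : 0 ≤ (L₁ * t + L₀) * Real.sqrt (s t) := by positivity
    have := (hγ t h0).1
    nlinarith)
  have hs2 := hcon T2 hT20
  have hs0 : 0 ≤ s T2 / g := div_nonneg (by linarith) hg.le
  have h3 := h2 (T2 + s T2 / g) (by linarith)
  have h4 := hcon (T2 + s T2 / g) (by linarith)
  have h5 : g * (T2 + s T2 / g - T2) = s T2 := by field_simp; ring
  linarith
end

section
/- For all (y₁, y₂) ∈ ℝ², the Lyapunov function V₁ satisfies the two-sided bound (3/(8 C₀)) ln(1 + 2 C₀ |y₁|) + g y₂²/2 ≤ V₁(y₁, y₂) ≤ (5/(8 C₀)) ln(1 + 2 C₀ |y₁|) + G y₂²/2; in particular V₁ is positive-definite. -/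
/-- The saturation function `σ(y) = sign(y) · min(|y|, 1)` (with `sign 0 = 0`). -/
noncomputable def sat (y : ℝ) : ℝ := Real.sign y * min |y| 1

/-- The switching gain `F(y₁, y₂) = g` if `sign(y₁) y₂ ≤ 0` and `G` otherwise. -/
noncomputable def Fgain (g G y₁ y₂ : ℝ) : ℝ :=
  if Real.sign y₁ * y₂ ≤ 0 then g else G

/-- The Lyapunov function
`V₁(y₁, y₂) = (ln(1 + 2C₀|y₁|)/(2C₀)) (1 - (1/4) sign(y₁) σ(y₂)) + F(y₁, y₂) y₂²/2`. -/
noncomputable def V1 (g G C₀ y₁ y₂ : ℝ) : ℝ :=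
  (Real.log (1 + 2 * C₀ * |y₁|) / (2 * C₀)) *
    (1 - (1 / 4) * Real.sign y₁ * sat y₂) + Fgain g G y₁ y₂ * y₂ ^ 2 / 2

/-- for all `(y₁, y₂) ∈ ℝ²`, the Lyapunov function `V₁` satisfies
`(3/(8C₀)) ln(1 + 2C₀|y₁|) + g y₂²/2 ≤ V₁(y₁, y₂) ≤ (5/(8C₀)) ln(1 + 2C₀|y₁|) + G y₂²/2`. -/
theorem V1_two_sided_bound (g G C₀ : ℝ) (hg : 0 < g) (hgG : g ≤ G) (hC₀ : 0 < C₀) :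
    ∀ y₁ y₂ : ℝ,
      (3 / (8 * C₀)) * Real.log (1 + 2 * C₀ * |y₁|) + g * y₂ ^ 2 / 2 ≤
        V1 g G C₀ y₁ y₂ ∧
      V1 g G C₀ y₁ y₂ ≤
        (5 / (8 * C₀)) * Real.log (1 + 2 * C₀ * |y₁|) + G * y₂ ^ 2 / 2 := by
  intro y₁ y₂
  have hL : 0 ≤ Real.log (1 + 2 * C₀ * |y₁|) := by
    apply Real.log_nonneg
    have : 0 ≤ 2 * C₀ * |y₁| := by positivity
    linarith
  have hs : |Real.sign y₁ * sat y₂| ≤ 1 := by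
    have h1 : ∀ x : ℝ, |Real.sign x| ≤ 1 := by
      intro x
      rcases Real.sign_apply_eq x with h | h | h <;> rw [h] <;> norm_num
    have h2 : |sat y₂| ≤ 1 := by
      unfold sat
      rw [abs_mul]
      have h3 : |min |y₂| 1| ≤ 1 := by
        rw [abs_of_nonneg (le_min (abs_nonneg _) zero_le_one)]
        exact min_le_right _ _
      exact mul_le_one₀ (h1 _) (abs_nonneg _) h3
    rw [abs_mul]
    exact mul_le_one₀ (h1 _) (abs_nonneg _) h2
  obtain ⟨hs1, hs2⟩ := abs_le.mp hs
  have hF : g ≤ Fgain g G y₁ y₂ ∧ Fgain g G y₁ y₂ ≤ G := by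
    unfold Fgain
    split_ifs
    · exact ⟨le_refl _, hgG⟩
    · exact ⟨hgG, le_refl _⟩
  have hF1 := mul_le_mul_of_nonneg_right hF.1 (sq_nonneg y₂)
  have hF2 := mul_le_mul_of_nonneg_right hF.2 (sq_nonneg y₂)
  unfold V1
  generalize Real.log (1 + 2 * C₀ * |y₁|) = L at *
  have e3 : 3 / (8 * C₀) * L = L / (2 * C₀) * (3 / 4) := by field_simp; ring
  have e5 : 5 / (8 * C₀) * L = L / (2 * C₀) * (5 / 4) := by field_simp; ring
  have hA : 0 ≤ L / (2 * C₀) := by positivity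
  rw [e3, e5]
  have a1 := mul_le_mul_of_nonneg_left hs1 hA
  have a2 := mul_le_mul_of_nonneg_left hs2 hA
  constructor <;> nlinarith
end

section
/- Let C₀ > 0 and τ₁ < τ₂. If y : [τ₁, τ₂] → ℝ is differentiable with y(τ) > 0 and y'(τ) / (1 + 2 C₀ y(τ)) ≤ -√(y(τ)) / 2 for all τ ∈ [τ₁, τ₂], then the function τ ↦ 1/√(y(τ)) is differentiable with derivative at least C₀/2 at every τ ∈ [τ₁, τ₂]; consequently τ₂ - τ₁ ≤ 2 / (C₀ √(y(τ₂))). -/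
/-- let `C₀ > 0` and `τ₁ < τ₂`. If `y : [τ₁, τ₂] → ℝ` is differentiable with
`y(τ) > 0` and `y'(τ)/(1 + 2C₀ y(τ)) ≤ -√(y τ)/2` on `[τ₁, τ₂]`, then `τ ↦ 1/√(y τ)` is
differentiable with derivative at least `C₀/2` at every `τ ∈ [τ₁, τ₂]`; consequently
`τ₂ - τ₁ ≤ 2/(C₀ √(y τ₂))`. -/
theorem crossing_time_bound (C₀ τ₁ τ₂ : ℝ) (hC₀ : 0 < C₀) (hττ : τ₁ < τ₂)
    (y : ℝ → ℝ)
    (hdiff : ∀ τ ∈ Set.Icc τ₁ τ₂, DifferentiableAt ℝ y τ)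
    (hpos : ∀ τ ∈ Set.Icc τ₁ τ₂, 0 < y τ)
    (hineq : ∀ τ ∈ Set.Icc τ₁ τ₂,
      deriv y τ / (1 + 2 * C₀ * y τ) ≤ -Real.sqrt (y τ) / 2) :
    (∀ τ ∈ Set.Icc τ₁ τ₂,
      DifferentiableAt ℝ (fun t => 1 / Real.sqrt (y t)) τ ∧
      C₀ / 2 ≤ deriv (fun t => 1 / Real.sqrt (y t)) τ) ∧
    τ₂ - τ₁ ≤ 2 / (C₀ * Real.sqrt (y τ₂)) := by
  have key : ∀ τ ∈ Set.Icc τ₁ τ₂,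
      DifferentiableAt ℝ (fun t => 1 / Real.sqrt (y t)) τ ∧
      C₀ / 2 ≤ deriv (fun t => 1 / Real.sqrt (y t)) τ := by
    intro τ hτ
    have hy := hpos τ hτ
    have hs : 0 < Real.sqrt (y τ) := Real.sqrt_pos.mpr hy
    have h1 := ((hdiff τ hτ).hasDerivAt.sqrt hy.ne').inv hs.ne'
    have h2 : HasDerivAt (fun t => 1 / Real.sqrt (y t))
        (-(deriv y τ / (2 * Real.sqrt (y τ))) / Real.sqrt (y τ) ^ 2) τ := by
      simp only [one_div]
      exact h1
    refine ⟨h2.differentiableAt, ?_⟩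
    rw [h2.deriv]
    have hi := hineq τ hτ
    rw [div_le_iff₀ (by positivity)] at hi
    have hsq : y τ = Real.sqrt (y τ) ^ 2 := (Real.sq_sqrt hy.le).symm
    generalize Real.sqrt (y τ) = s at *
    generalize deriv y τ = d at *
    rw [hsq] at hi
    have e : -(d / (2 * s)) / s ^ 2 = (-d) / (2 * s ^ 3) := by
      field_simp
    rw [e, le_div_iff₀ (by positivity)]
    nlinarith [hi, hs]
  refine ⟨key, ?_⟩
  have hm := (convex_Icc τ₁ τ₂).mul_sub_le_image_sub_of_le_deriv
    (f := fun t => 1 / Real.sqrt (y t))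
    (fun t ht => (key t ht).1.continuousAt.continuousWithinAt)
    (fun t ht => (key t (interior_subset ht)).1.differentiableWithinAt)
    (fun t ht => (key t (interior_subset ht)).2)
    τ₁ (Set.left_mem_Icc.mpr hττ.le) τ₂ (Set.right_mem_Icc.mpr hττ.le) hττ.le
  have hs2 : 0 < Real.sqrt (y τ₂) := Real.sqrt_pos.mpr (hpos τ₂ (Set.right_mem_Icc.mpr hττ.le))
  have h0 : 0 ≤ 1 / Real.sqrt (y τ₁) := by positivity
  have h3 : C₀ / 2 * (τ₂ - τ₁) ≤ 1 / Real.sqrt (y τ₂) := by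
    linarith
  rw [le_div_iff₀ hs2] at h3
  rw [le_div_iff₀ (by positivity)]
  linarith
end
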